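/- arXiv:2303.08615 — 4 statements merged into one kernel-verified Lean document; each statement's English description precedes it below -/
import Mathlib

section
/- Let q < 1 be real, let a = sqrt(2/(1-q)) and θ = (2-q)/(1-q), and let Z have the standard Tsallis q-Gaussian distribution with parameter q, i.e., Z is distributed as a·(2B - 1) where B ~ Beta(θ, θ). Then for all t ∈ ℝ the characteristic function of Z is real-valued and equals the confluent hypergeometric series ₀F₁(θ + 1/2; -(a·t)²/4) = Σ_{n=0}^∞ (-(a·t)²/4)^n / ((θ + 1/2)_n · n!), where (c)_n denotes the rising factorial (Pochhammer symbol) c·(c+1)···(c+n-1). -/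
open Real MeasureTheory Complex

theorem intervalIntegrable_rpow_mul_one_sub_rpow {α β : ℝ} (hα : 0 < α) (hβ : 0 < β) :
    IntervalIntegrable (fun u : ℝ => u ^ (α - 1) * (1 - u) ^ (β - 1)) volume 0 1 := by
  have h := betaIntegral_convergent (u := α) (v := β) (by simpa) (by simpa)
  rw [intervalIntegrable_iff_integrableOn_Ioc_of_le zero_le_one] at h ⊢
  refine IntegrableOn.congr_fun (Integrable.re h) (fun x hx => ?_) measurableSet_Ioc
  norm_cast
  rw [← Complex.ofReal_cpow hx.1.le, ← Complex.ofReal_cpow (sub_nonneg.2 hx.2),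
    ← Complex.ofReal_mul]
  exact Complex.ofReal_re _

theorem integral_rpow_mul_one_sub_rpow {α β : ℝ} (hα : 0 < α) (hβ : 0 < β) :
    ∫ u in (0 : ℝ)..1, u ^ (α - 1) * (1 - u) ^ (β - 1) = ProbabilityTheory.beta α β := by
  have h : betaIntegral α β =
      ((∫ u in (0 : ℝ)..1, u ^ (α - 1) * (1 - u) ^ (β - 1) : ℝ) : ℂ) := by
    rw [betaIntegral, ← intervalIntegral.integral_ofReal]
    refine intervalIntegral.integral_congr fun x hx => ?_
    rw [Set.uIcc_of_le zero_le_one] at hx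
    rw [Complex.ofReal_mul, Complex.ofReal_cpow hx.1, Complex.ofReal_cpow (sub_nonneg.2 hx.2)]
    push_cast
    rfl
  rw [ProbabilityTheory.beta_eq_betaIntegralReal α β hα hβ, h, Complex.ofReal_re]

theorem beta_add_one_add_one_self {θ : ℝ} (hθ : 0 < θ) :
    ProbabilityTheory.beta (θ + 1) (θ + 1) =
      θ / (2 * (2 * θ + 1)) * ProbabilityTheory.beta θ θ := by
  have h : Real.Gamma (θ + 1 + (θ + 1)) = (2 * θ + 1) * (2 * θ * Real.Gamma (θ + θ)) := by
    rw [show θ + 1 + (θ + 1) = (2 * θ + 1) + 1 by ring, Real.Gamma_add_one (by positivity),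
      Real.Gamma_add_one (by positivity), two_mul]
  have hΓ : Real.Gamma (θ + θ) ≠ 0 := (Real.Gamma_pos_of_pos (by positivity)).ne'
  rw [ProbabilityTheory.beta, ProbabilityTheory.beta, h, Real.Gamma_add_one hθ.ne']
  field_simp

theorem mul_eval_ascPochhammer_add_one (x : ℝ) (n : ℕ) :
    x * (ascPochhammer ℝ n).eval (x + 1) = (ascPochhammer ℝ n).eval x * (x + n) := by
  rw [← ascPochhammer_succ_eval, ascPochhammer_succ_left]
  simp

/-- The even moments of `2B - 1` for `B ~ Beta(θ, θ)`, up to normalization. -/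
theorem integral_pow_two_mul_mul_symmetric_beta_kernel (n : ℕ) {θ : ℝ} (hθ : 0 < θ) :
    ∫ u in (0 : ℝ)..1, (u ^ (θ - 1) * (1 - u) ^ (θ - 1)) * (2 * u - 1) ^ (2 * n) =
      ProbabilityTheory.beta θ θ *
        ((ascPochhammer ℝ n).eval (1 / 2) / (ascPochhammer ℝ n).eval (θ + 1 / 2)) := by
  induction n generalizing θ with
  | zero => simp [integral_rpow_mul_one_sub_rpow hθ hθ]
  | succ n ih =>
    have hint : ∀ {η : ℝ}, 0 < η → IntervalIntegrable
        (fun u : ℝ => (u ^ (η - 1) * (1 - u) ^ (η - 1)) * (2 * u - 1) ^ (2 * n)) volume 0 1 :=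
      fun hη => (intervalIntegrable_rpow_mul_one_sub_rpow hη hη).mul_continuousOn
        (by fun_prop)
    have hθ' : 0 < θ + 1 := by positivity
    have hsplit : ∫ u in (0 : ℝ)..1,
          (u ^ (θ - 1) * (1 - u) ^ (θ - 1)) * (2 * u - 1) ^ (2 * (n + 1)) =
        (∫ u in (0 : ℝ)..1, (u ^ (θ - 1) * (1 - u) ^ (θ - 1)) * (2 * u - 1) ^ (2 * n)) -
        4 * ∫ u in (0 : ℝ)..1,
          (u ^ (θ + 1 - 1) * (1 - u) ^ (θ + 1 - 1)) * (2 * u - 1) ^ (2 * n) := by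
      rw [← intervalIntegral.integral_const_mul,
        ← intervalIntegral.integral_sub (hint hθ) ((hint hθ').const_mul 4)]
      refine intervalIntegral.integral_congr fun u hu => ?_
      rw [Set.uIcc_of_le zero_le_one] at hu
      have h : ∀ {x : ℝ}, 0 ≤ x → x ^ (θ + 1 - 1) = x ^ (θ - 1) * x := fun {x} hx => by
        rw [← Real.rpow_add_one' hx (by simpa using hθ.ne')]
        ring_nf
      rw [h hu.1, h (sub_nonneg.2 hu.2)]
      ring
    have hpos : 0 < (ascPochhammer ℝ n).eval (θ + 1 / 2) :=
      ascPochhammer_pos n _ (by positivity)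
    have hpos' : 0 < (ascPochhammer ℝ n).eval (θ + 1 + 1 / 2) :=
      ascPochhammer_pos n _ (by positivity)
    have hshift := mul_eval_ascPochhammer_add_one (θ + 1 / 2) n
    rw [show θ + 1 / 2 + 1 = θ + 1 + 1 / 2 by ring] at hshift
    have hne : θ + 1 / 2 ≠ 0 := by positivity
    have heval : (ascPochhammer ℝ n).eval (θ + 1 + 1 / 2) =
        (ascPochhammer ℝ n).eval (θ + 1 / 2) * (θ + 1 / 2 + n) / (θ + 1 / 2) := by
      rw [← hshift, mul_div_cancel_left₀ _ hne]
    rw [hsplit, ih hθ, ih hθ', beta_add_one_add_one_self hθ, heval, ascPochhammer_succ_eval,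
      ascPochhammer_succ_eval]
    have hne' : θ + 1 / 2 + n ≠ 0 := by positivity
    field_simp
    ring

theorem factorial_two_mul_eq_ascPochhammer_half (n : ℕ) :
    ((2 * n).factorial : ℝ) =
      4 ^ n * (n.factorial : ℝ) * (ascPochhammer ℝ n).eval (1 / 2) := by
  induction n with
  | zero => simp
  | succ n ih =>
    rw [show 2 * (n + 1) = 2 * n + 1 + 1 by ring, Nat.factorial_succ, Nat.factorial_succ,
      Nat.factorial_succ, ascPochhammer_succ_eval]
    push_cast
    rw [ih]
    ring

theorem hasSum_integral_symmetric_beta_kernel_mul_cos {θ : ℝ} (hθ : 0 < θ) (s : ℝ) :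
    HasSum (fun n : ℕ => ProbabilityTheory.beta θ θ * ((-s ^ 2 / 4) ^ n /
        ((ascPochhammer ℝ n).eval (θ + 1 / 2) * (n.factorial : ℝ))))
      (∫ u in (0 : ℝ)..1,
        (u ^ (θ - 1) * (1 - u) ^ (θ - 1)) * Real.cos (s * (2 * u - 1))) := by
  have hw := intervalIntegrable_rpow_mul_one_sub_rpow hθ hθ
  have key := intervalIntegral.hasSum_integral_of_dominated_convergence (μ := volume)
    (a := 0) (b := 1)
    (F := fun (n : ℕ) (u : ℝ) => (u ^ (θ - 1) * (1 - u) ^ (θ - 1)) *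
      ((-1) ^ n * (s * (2 * u - 1)) ^ (2 * n) / ((2 * n).factorial : ℝ)))
    (f := fun u : ℝ => (u ^ (θ - 1) * (1 - u) ^ (θ - 1)) * Real.cos (s * (2 * u - 1)))
    (fun n u => ‖u ^ (θ - 1) * (1 - u) ^ (θ - 1)‖ * (s ^ (2 * n) / ((2 * n).factorial : ℝ)))
    (fun n => by fun_prop)
    (fun n => Filter.Eventually.of_forall fun u hu => by
      rw [Set.uIoc_of_le zero_le_one] at hu
      have h1 : (2 * u - 1) ^ (2 * n) ≤ 1 := by
        rw [pow_mul]
        exact pow_le_one₀ (sq_nonneg _) (by nlinarith [hu.1, hu.2])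
      have h2 : ∀ x : ℝ, 0 ≤ x ^ (2 * n) := fun x => (even_two_mul n).pow_nonneg x
      rw [norm_mul]
      gcongr
      rw [norm_div, norm_mul, norm_pow, norm_neg, norm_one, one_pow, one_mul,
        Real.norm_of_nonneg (h2 _), Real.norm_of_nonneg (Nat.cast_nonneg _), mul_pow]
      gcongr
      exact mul_le_of_le_one_right (h2 s) h1)
    (Filter.Eventually.of_forall fun u _ => (Real.hasSum_cosh s).summable.mul_left _)
    (by
      simp_rw [tsum_mul_left]
      exact hw.norm.mul_const _)
    (Filter.Eventually.of_forall fun u _ => (Real.hasSum_cos _).mul_left _)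
  convert! key using 2 with n
  have hsplit : ∀ u : ℝ, (u ^ (θ - 1) * (1 - u) ^ (θ - 1)) *
      ((-1) ^ n * (s * (2 * u - 1)) ^ (2 * n) / ((2 * n).factorial : ℝ)) =
      ((-1) ^ n * s ^ (2 * n) / ((2 * n).factorial : ℝ)) *
        ((u ^ (θ - 1) * (1 - u) ^ (θ - 1)) * (2 * u - 1) ^ (2 * n)) := fun u => by
    rw [mul_pow]; ring
  simp_rw [hsplit]
  rw [intervalIntegral.integral_const_mul, integral_pow_two_mul_mul_symmetric_beta_kernel n hθ,
    factorial_two_mul_eq_ascPochhammer_half]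
  have hpos : 0 < (ascPochhammer ℝ n).eval (θ + 1 / 2) :=
    ascPochhammer_pos n _ (by positivity)
  have hpos' : 0 < (ascPochhammer ℝ n).eval (1 / 2 : ℝ) :=
    ascPochhammer_pos n _ (by positivity)
  rw [div_pow, neg_pow, ← pow_mul]
  field_simp

theorem integral_symmetric_beta_kernel_mul_sin (θ s : ℝ) :
    ∫ u in (0 : ℝ)..1, (u ^ (θ - 1) * (1 - u) ^ (θ - 1)) * Real.sin (s * (2 * u - 1)) = 0 := by
  have h := intervalIntegral.integral_comp_sub_left (a := 0) (b := 1)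
    (fun u : ℝ => (u ^ (θ - 1) * (1 - u) ^ (θ - 1)) * Real.sin (s * (2 * u - 1))) 1
  have hneg : ∀ u : ℝ, ((1 - u) ^ (θ - 1) * (1 - (1 - u)) ^ (θ - 1)) *
      Real.sin (s * (2 * (1 - u) - 1)) =
      -((u ^ (θ - 1) * (1 - u) ^ (θ - 1)) * Real.sin (s * (2 * u - 1))) := fun u => by
    rw [show s * (2 * (1 - u) - 1) = -(s * (2 * u - 1)) by ring, Real.sin_neg, sub_sub_cancel]
    ring
  simp_rw [hneg] at h
  rw [intervalIntegral.integral_neg, sub_self, sub_zero] at h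
  linarith

/-- The characteristic function of `2B - 1` for `B ~ Beta(θ, θ)`, up to normalization. -/
theorem integral_symmetric_beta_kernel_mul_cexp {θ : ℝ} (hθ : 0 < θ) (s : ℝ) :
    ∫ u in (0 : ℝ)..1, ((u ^ (θ - 1) * (1 - u) ^ (θ - 1) : ℝ) : ℂ) *
        Complex.exp (Complex.I * (s * (2 * u - 1) : ℝ)) =
      ((∫ u in (0 : ℝ)..1,
        (u ^ (θ - 1) * (1 - u) ^ (θ - 1)) * Real.cos (s * (2 * u - 1)) : ℝ) : ℂ) := by
  have hw := intervalIntegrable_rpow_mul_one_sub_rpow hθ hθ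
  have hcos : IntervalIntegrable (fun u : ℝ =>
      (u ^ (θ - 1) * (1 - u) ^ (θ - 1)) * Real.cos (s * (2 * u - 1))) volume 0 1 :=
    hw.mul_continuousOn (by fun_prop)
  have hsin : IntervalIntegrable (fun u : ℝ =>
      (u ^ (θ - 1) * (1 - u) ^ (θ - 1)) * Real.sin (s * (2 * u - 1))) volume 0 1 :=
    hw.mul_continuousOn (by fun_prop)
  have hcosℂ : IntervalIntegrable (fun u : ℝ =>
      (((u ^ (θ - 1) * (1 - u) ^ (θ - 1)) * Real.cos (s * (2 * u - 1)) : ℝ) : ℂ)) volume 0 1 :=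
    ⟨hcos.1.ofReal, hcos.2.ofReal⟩
  have hsinℂ : IntervalIntegrable (fun u : ℝ =>
      (((u ^ (θ - 1) * (1 - u) ^ (θ - 1)) * Real.sin (s * (2 * u - 1)) : ℝ) : ℂ)) volume 0 1 :=
    ⟨hsin.1.ofReal, hsin.2.ofReal⟩
  have hexp : ∀ u : ℝ, ((u ^ (θ - 1) * (1 - u) ^ (θ - 1) : ℝ) : ℂ) *
        Complex.exp (Complex.I * (s * (2 * u - 1) : ℝ)) =
      (((u ^ (θ - 1) * (1 - u) ^ (θ - 1)) * Real.cos (s * (2 * u - 1)) : ℝ) : ℂ) +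
      (((u ^ (θ - 1) * (1 - u) ^ (θ - 1)) * Real.sin (s * (2 * u - 1)) : ℝ) : ℂ) *
        Complex.I := fun u => by
    rw [mul_comm Complex.I, Complex.exp_mul_I, Complex.ofReal_mul _ (Real.cos _),
      Complex.ofReal_mul _ (Real.sin _), Complex.ofReal_cos, Complex.ofReal_sin]
    ring
  simp_rw [hexp]
  rw [intervalIntegral.integral_add hcosℂ (hsinℂ.mul_const _),
    intervalIntegral.integral_mul_const, intervalIntegral.integral_ofReal,
    intervalIntegral.integral_ofReal, integral_symmetric_beta_kernel_mul_sin]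
  simp

/-- For `q < 1`, the characteristic function of the standard Tsallis q-Gaussian `Z = a·(2B - 1)`
(with `B ~ Beta(θ, θ)`, `a = √(2/(1-q))`, `θ = (2-q)/(1-q)`) is real-valued and equals the
confluent hypergeometric series `₀F₁(θ + 1/2; -(a·t)²/4)`. -/
theorem charFun_tsallis_qGaussian_q_lt_one
    {Ω : Type*} [MeasureSpace Ω] [IsProbabilityMeasure (volume : Measure Ω)]
    (q : ℝ) (hq : q < 1)
    (a : ℝ) (ha : a = Real.sqrt (2 / (1 - q)))
    (θ : ℝ) (hθ : θ = (2 - q) / (1 - q))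
    (B : Ω → ℝ) (hB : Measurable B)
    (hlaw : Measure.map B volume =
      (volume.restrict (Set.Ioo (0 : ℝ) 1)).withDensity
        (fun u => ENNReal.ofReal (u ^ (θ - 1) * (1 - u) ^ (θ - 1) /
          (Real.Gamma θ * Real.Gamma θ / Real.Gamma (2 * θ)))))
    (Z : Ω → ℝ) (hZ : ∀ ω, Z ω = a * (2 * B ω - 1)) :
    ∀ t : ℝ,
      (∫ ω, Complex.exp (Complex.I * t * (Z ω)))
        = ((∑' n : ℕ, (-(a * t) ^ 2 / 4) ^ n /
            (Polynomial.eval (θ + 1 / 2) (ascPochhammer ℝ n) * (n.factorial : ℝ))) : ℝ) := by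
  intro t
  have hq' : 0 < 1 - q := sub_pos.2 hq
  have hθpos : 0 < θ := hθ ▸ div_pos (by linarith) hq'
  have hβ : 0 < ProbabilityTheory.beta θ θ := ProbabilityTheory.beta_pos hθpos hθpos
  have hβeq : Real.Gamma θ * Real.Gamma θ / Real.Gamma (2 * θ) =
      ProbabilityTheory.beta θ θ := by rw [ProbabilityTheory.beta, two_mul]
  rw [hβeq] at hlaw
  have hZB : ∀ ω, Complex.exp (Complex.I * t * (Z ω)) =
      (fun u : ℝ => Complex.exp (Complex.I * ((a * t) * (2 * u - 1) : ℝ))) (B ω) := fun ω => by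
    dsimp only
    rw [hZ]
    push_cast
    ring_nf
  rw [integral_congr_ae (Filter.Eventually.of_forall hZB), ← integral_map
      (f := fun u : ℝ => Complex.exp (Complex.I * ((a * t) * (2 * u - 1) : ℝ)))
      hB.aemeasurable (Continuous.aestronglyMeasurable (by fun_prop)), hlaw,
    integral_withDensity_eq_integral_toReal_smul (by fun_prop) (by simp),
    setIntegral_congr_fun (g := fun u : ℝ => ((ProbabilityTheory.beta θ θ : ℂ)⁻¹ *
      (((u ^ (θ - 1) * (1 - u) ^ (θ - 1) : ℝ) : ℂ) *
        Complex.exp (Complex.I * ((a * t) * (2 * u - 1) : ℝ))))) measurableSet_Ioo ?_,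
    integral_const_mul, ← integral_Ioc_eq_integral_Ioo,
    ← intervalIntegral.integral_of_le zero_le_one,
    integral_symmetric_beta_kernel_mul_cexp hθpos,
    ← (hasSum_integral_symmetric_beta_kernel_mul_cos hθpos (a * t)).tsum_eq, tsum_mul_left,
    Complex.ofReal_mul, inv_mul_cancel_left₀ (Complex.ofReal_ne_zero.2 hβ.ne')]
  intro u hu
  have hu' : 0 ≤ 1 - u := sub_nonneg.2 hu.2.le
  have hu0 : 0 ≤ u := hu.1.le
  dsimp only
  rw [ENNReal.toReal_ofReal (by positivity), Complex.real_smul, Complex.ofReal_div]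
  ring
end

section
/- Let ν > 0 and let T have the Student t distribution with ν degrees of freedom. Then for every t ≠ 0 the characteristic function of T satisfies E[exp(i·t·T)] = ((sqrt(ν)·|t|)^(ν/2) / (2^(ν/2 - 1)·Γ(ν/2))) · ∫₀^∞ exp(-sqrt(ν)·|t|·cosh(u))·cosh((ν/2)·u) du, where the integral is the standard integral representation of the modified Bessel function of the second kind K_{ν/2}(sqrt(ν)·|t|). -/
open Real MeasureTheory Complex

/-- An integral over `ℝ` folded onto the positive half-line. -/
theorem integral_eq_integral_Ioi_add_comp_neg {g : ℝ → ℝ} (hg : Integrable g) :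
    ∫ u, g u = ∫ u in Set.Ioi (0 : ℝ), (g u + g (-u)) := by
  have hneg : ∫ u in Set.Ioi (0 : ℝ), g (-u) = ∫ u in Set.Iic (0 : ℝ), g u := by
    rw [integral_comp_neg_Ioi, neg_zero]
  rw [integral_add hg.integrableOn hg.comp_neg.integrableOn, hneg, add_comm,
    intervalIntegral.integral_Iic_add_Ioi hg.integrableOn hg.integrableOn]

theorem integrableOn_rpow_mul_exp_neg_sub_div {p c : ℝ} (hp : 0 < p) (hc : 0 ≤ c) :
    IntegrableOn (fun s : ℝ => s ^ (p - 1) * Real.exp (-s - c / s)) (Set.Ioi 0) := by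
  refine (Real.GammaIntegral_convergent hp).mono'
    (by apply Measurable.aestronglyMeasurable; fun_prop) ?_
  filter_upwards [ae_restrict_mem measurableSet_Ioi] with s hs
  have hs : 0 < s := hs
  rw [Real.norm_of_nonneg (by positivity), mul_comm]
  gcongr
  have : 0 ≤ c / s := by positivity
  linarith

/-- The two standard integral representations of the modified Bessel function of the second kind
`K_p(z)` agree. -/
theorem integral_rpow_mul_exp_neg_sub_div {p z : ℝ} (hp : 0 < p) (hz : 0 < z) :
    ∫ s in Set.Ioi (0 : ℝ), s ^ (p - 1) * Real.exp (-s - z ^ 2 / 4 / s) =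
      2 * (z / 2) ^ p *
        ∫ u in Set.Ioi (0 : ℝ), Real.exp (-z * Real.cosh u) * Real.cosh (p * u) := by
  set f : ℝ → ℝ := fun s => s ^ (p - 1) * Real.exp (-s - z ^ 2 / 4 / s) with hf
  have himage : (fun u => z / 2 * Real.exp u) '' Set.univ = Set.Ioi 0 := by
    ext s
    constructor
    · rintro ⟨u, -, rfl⟩
      exact Set.mem_Ioi.2 (by positivity)
    · intro hs
      have hs : 0 < s := hs
      refine ⟨Real.log (s / (z / 2)), Set.mem_univ _, ?_⟩
      simp only
      rw [Real.exp_log (by positivity)]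
      field_simp
  have hderiv : ∀ u ∈ (Set.univ : Set ℝ),
      HasDerivWithinAt (fun u => z / 2 * Real.exp u) (z / 2 * Real.exp u) Set.univ u :=
    fun u _ => ((Real.hasDerivAt_exp u).const_mul (z / 2)).hasDerivWithinAt
  have hinj : Set.InjOn (fun u => z / 2 * Real.exp u) Set.univ := fun u _ v _ huv =>
    Real.exp_injective (mul_left_cancel₀ (by positivity) huv)
  have hsubst (u : ℝ) : |z / 2 * Real.exp u| • f (z / 2 * Real.exp u) =
      (z / 2) ^ p * (Real.exp (-z * Real.cosh u) * Real.exp (p * u)) := by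
    have hpos : 0 < z / 2 * Real.exp u := by positivity
    have hexp : -(z / 2 * Real.exp u) - z ^ 2 / 4 / (z / 2 * Real.exp u) = -z * Real.cosh u := by
      rw [Real.cosh_eq, Real.exp_neg]
      field_simp
      ring
    simp only [hf]
    rw [abs_of_pos hpos, smul_eq_mul, hexp, ← mul_assoc, ← Real.rpow_one_add' hpos.le
      (by linarith), add_sub_cancel, Real.mul_rpow (by positivity) (by positivity),
      ← Real.exp_mul, mul_comm u p]
    ring
  have hint := integrableOn_rpow_mul_exp_neg_sub_div hp (c := z ^ 2 / 4) (by positivity)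
  rw [← himage, integrableOn_image_iff_integrableOn_abs_deriv_smul MeasurableSet.univ hderiv hinj]
    at hint
  change IntegrableOn (fun u => |z / 2 * Real.exp u| • f (z / 2 * Real.exp u)) Set.univ at hint
  simp only [hsubst, integrableOn_univ] at hint
  have himage_integral :=
    integral_image_eq_integral_abs_deriv_smul MeasurableSet.univ hderiv hinj f
  simp only [hsubst, setIntegral_univ, himage] at himage_integral
  rw [himage_integral, integral_eq_integral_Ioi_add_comp_neg hint, ← integral_const_mul]
  refine integral_congr_ae (ae_of_all _ fun u => ?_)
  simp only [Real.cosh_neg, mul_neg, Real.cosh_eq (p * u)]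
  ring

/-- The Fourier transform of `x ↦ (1 + x ^ 2 / ν) ^ (-a)`, through the representation of this
function as a Gamma mixture of Gaussians. -/
theorem integral_cexp_mul_one_add_sq_div_rpow {ν a : ℝ} (hν : 0 < ν) (ha : 1 / 2 < a) (t : ℝ) :
    ∫ x : ℝ, cexp (I * t * x) * (((1 + x ^ 2 / ν) ^ (-a) * Real.Gamma a : ℝ) : ℂ) =
      ((√(π * ν) * ∫ s in Set.Ioi (0 : ℝ),
        s ^ (a - 1 / 2 - 1) * Real.exp (-s - ν * t ^ 2 / 4 / s) : ℝ) : ℂ) := by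
  set w : ℝ → ℝ → ℝ := fun x s => s ^ (a - 1) * Real.exp (-((1 + x ^ 2 / ν) * s)) with hw
  have hw_split (x s : ℝ) :
      w x s = s ^ (a - 1) * Real.exp (-s) * Real.exp (-(s / ν) * x ^ 2) := by
    simp only [hw]
    rw [mul_assoc, ← Real.exp_add]
    congr 2
    ring
  have hmix (x : ℝ) : ∫ s in Set.Ioi (0 : ℝ), w x s = (1 + x ^ 2 / ν) ^ (-a) * Real.Gamma a := by
    have hx : 0 < 1 + x ^ 2 / ν := by positivity
    rw [hw, Real.integral_rpow_mul_exp_neg_mul_Ioi (by linarith) hx, one_div,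
      Real.inv_rpow hx.le, Real.rpow_neg hx.le]
  have hnorm (x : ℝ) {s : ℝ} (hs : 0 < s) : ‖cexp (I * t * x) * (w x s : ℂ)‖ = w x s := by
    rw [norm_mul, Complex.norm_real, Real.norm_of_nonneg (by rw [hw_split]; positivity),
      show I * t * x = ((t * x : ℝ) : ℂ) * I by push_cast; ring, Complex.norm_exp_ofReal_mul_I,
      one_mul]
  have hsqrt {s : ℝ} (hs : 0 < s) :
      s ^ (a - 1) * √(π / (s / ν)) = √(π * ν) * s ^ (a - 1 / 2 - 1) := by
    rw [show π / (s / ν) = π * ν / s by field_simp, Real.sqrt_div (by positivity),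
      Real.sqrt_eq_rpow s, sub_right_comm a, Real.rpow_sub hs (a - 1)]
    ring
  have hmeas : Measurable (Function.uncurry fun x s : ℝ => cexp (I * t * x) * (w x s : ℂ)) := by
    simp only [hw, Function.uncurry_def]
    fun_prop
  have hint : Integrable (Function.uncurry fun x s : ℝ => cexp (I * t * x) * (w x s : ℂ))
      (volume.prod (volume.restrict (Set.Ioi 0))) := by
    rw [integrable_prod_iff' hmeas.aestronglyMeasurable]
    constructor
    · filter_upwards [ae_restrict_mem measurableSet_Ioi] with s hs
      have hs : 0 < s := hs
      have hgauss := (integrable_exp_neg_mul_sq (div_pos hs hν)).const_mul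
        (s ^ (a - 1) * Real.exp (-s))
      refine hgauss.mono' (hmeas.comp measurable_prodMk_right).aestronglyMeasurable
        (ae_of_all _ fun x => ?_)
      simp only [Function.uncurry_apply_pair, hnorm x hs]
      exact (hw_split x s).le
    · refine (((Real.GammaIntegral_convergent (s := a - 1 / 2) (by linarith)).const_mul
        √(π * ν))).congr ?_
      filter_upwards [ae_restrict_mem measurableSet_Ioi] with s hs
      simp only [Function.uncurry_apply_pair, hnorm _ (Set.mem_Ioi.1 hs)]
      simp only [hw_split]
      rw [integral_const_mul, integral_gaussian, mul_right_comm, hsqrt hs]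
      ring
  have hfourier {s : ℝ} (hs : 0 < s) : ∫ x : ℝ, cexp (I * t * x) * (w x s : ℂ) =
      ((√(π * ν) * (s ^ (a - 1 / 2 - 1) * Real.exp (-s - ν * t ^ 2 / 4 / s)) : ℝ) : ℂ) := by
    have hb : 0 < ((s / ν : ℝ) : ℂ).re := by rw [Complex.ofReal_re]; positivity
    have hrw (x : ℝ) : cexp (I * t * x) * (w x s : ℂ) = ((s ^ (a - 1) * Real.exp (-s) : ℝ) : ℂ) *
        (cexp (I * t * x) * cexp (-((s / ν : ℝ) : ℂ) * (x : ℂ) ^ 2)) := by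
      rw [hw_split]
      push_cast
      ring
    have hroot : ((π : ℂ) / ((s / ν : ℝ) : ℂ)) ^ (1 / 2 : ℂ) = ((√(π / (s / ν)) : ℝ) : ℂ) := by
      rw [Real.sqrt_eq_rpow, Complex.ofReal_cpow (by positivity)]
      push_cast
      rfl
    have hexp : cexp (-(t : ℂ) ^ 2 / (4 * ((s / ν : ℝ) : ℂ))) =
        ((Real.exp (-(ν * t ^ 2 / 4 / s)) : ℝ) : ℂ) := by
      push_cast
      congr 1
      have : (s : ℂ) ≠ 0 := by exact_mod_cast hs.ne'
      have : (ν : ℂ) ≠ 0 := by exact_mod_cast hν.ne'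
      field_simp
    simp only [hrw]
    rw [integral_const_mul, fourierIntegral_gaussian hb, hroot, hexp, ← Complex.ofReal_mul,
      ← Complex.ofReal_mul, ← mul_assoc √(π * ν), ← hsqrt hs, sub_eq_add_neg (-s), Real.exp_add]
    congr 1
    ring
  calc ∫ x : ℝ, cexp (I * t * x) * (((1 + x ^ 2 / ν) ^ (-a) * Real.Gamma a : ℝ) : ℂ)
      = ∫ x : ℝ, ∫ s in Set.Ioi (0 : ℝ), cexp (I * t * x) * (w x s : ℂ) := by
        refine integral_congr_ae (ae_of_all _ fun x => ?_)
        simp only [integral_const_mul, integral_complex_ofReal, hmix]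
    _ = ∫ s in Set.Ioi (0 : ℝ), ∫ x : ℝ, cexp (I * t * x) * (w x s : ℂ) :=
        integral_integral_swap hint
    _ = ∫ s in Set.Ioi (0 : ℝ), ((√(π * ν) *
          (s ^ (a - 1 / 2 - 1) * Real.exp (-s - ν * t ^ 2 / 4 / s)) : ℝ) : ℂ) :=
        setIntegral_congr_fun measurableSet_Ioi fun s hs => hfourier hs
    _ = _ := by rw [integral_complex_ofReal, integral_const_mul]

/-- The characteristic function of the Student t distribution with `ν > 0` degrees of freedom:
for `t ≠ 0`, `E[exp(i·t·T)] = ((√ν·|t|)^(ν/2) / (2^(ν/2-1)·Γ(ν/2))) · K_{ν/2}(√ν·|t|)`, the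
Bessel function `K` being given by its standard integral representation. -/
theorem charFun_studentT
    {Ω : Type*} [MeasureSpace Ω] [IsProbabilityMeasure (volume : Measure Ω)]
    (ν : ℝ) (hν : 0 < ν)
    (T : Ω → ℝ) (hT : Measurable T)
    (hlaw : Measure.map T volume =
      volume.withDensity (fun x => ENNReal.ofReal
        (Real.Gamma ((ν + 1) / 2) / (Real.sqrt (ν * π) * Real.Gamma (ν / 2)) *
          (1 + x ^ 2 / ν) ^ (-((ν + 1) / 2))))) :
    ∀ t : ℝ, t ≠ 0 →
      (∫ ω, Complex.exp (Complex.I * t * (T ω)))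
        = (((Real.sqrt ν * |t|) ^ (ν / 2) / ((2 : ℝ) ^ (ν / 2 - 1) * Real.Gamma (ν / 2))) *
            ∫ u in Set.Ioi (0 : ℝ),
              Real.exp (-(Real.sqrt ν * |t|) * Real.cosh u) * Real.cosh ((ν / 2) * u) : ℝ) := by
  intro t ht
  have hz : 0 < √ν * |t| := mul_pos (Real.sqrt_pos.2 hν) (abs_pos.2 ht)
  have hΓ : 0 < Real.Gamma ((ν + 1) / 2) := Real.Gamma_pos_of_pos (by linarith)
  have hΓ' : 0 < Real.Gamma (ν / 2) := Real.Gamma_pos_of_pos (by linarith)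
  set C : ℝ := (√(ν * π) * Real.Gamma (ν / 2))⁻¹ with hC
  have hdensity (x : ℝ) :
      (ENNReal.ofReal (Real.Gamma ((ν + 1) / 2) / (√(ν * π) * Real.Gamma (ν / 2)) *
        (1 + x ^ 2 / ν) ^ (-((ν + 1) / 2)))).toReal • cexp (I * t * x) =
      (C : ℂ) * (cexp (I * t * x) *
        (((1 + x ^ 2 / ν) ^ (-((ν + 1) / 2)) * Real.Gamma ((ν + 1) / 2) : ℝ) : ℂ)) := by
    rw [ENNReal.toReal_ofReal (by positivity), Complex.real_smul, hC]
    push_cast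
    ring
  have hmap : ∫ ω, cexp (I * t * T ω) = ∫ x : ℝ, cexp (I * t * x) ∂(Measure.map T volume) :=
    (integral_map (f := fun x : ℝ => cexp (I * t * x)) hT.aemeasurable
      (by apply Measurable.aestronglyMeasurable; fun_prop)).symm
  have hfourier := integral_cexp_mul_one_add_sq_div_rpow hν
    (a := (ν + 1) / 2) (by linarith) t
  have hbessel := integral_rpow_mul_exp_neg_sub_div (p := ν / 2) (half_pos hν) hz
  rw [mul_pow, Real.sq_sqrt hν.le, sq_abs] at hbessel
  rw [show (ν + 1) / 2 - 1 / 2 = ν / 2 by ring, hbessel] at hfourier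
  rw [hmap, hlaw, integral_withDensity_eq_integral_toReal_smul (by fun_prop)
    (ae_of_all _ fun _ => ENNReal.ofReal_lt_top)]
  simp only [hdensity]
  rw [integral_const_mul, hfourier, ← Complex.ofReal_mul, hC, Complex.ofReal_inj,
    Real.div_rpow hz.le zero_le_two, Real.rpow_sub_one two_ne_zero, mul_comm ν π]
  have hroot : 0 < √(π * ν) := by positivity
  field_simp
end

section
/- Let X be a real random variable whose characteristic function φ(t) = E[exp(i·t·X)] is Lebesgue integrable on ℝ. Then X has a continuous probability density function given for every x ∈ ℝ by pdf_X(x) = (1/π)·∫₀^∞ Re(exp(-i·t·x)·φ(t)) dt. -/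
open Real MeasureTheory Complex

open scoped FourierTransform SchwartzMap ComplexConjugate

/-- A finite measure integrates a Schwartz function `g` as the Fourier transform of its rescaled
characteristic function does. -/
lemma integral_schwartz_eq_integral_mul_fourier_charFun (μ : Measure ℝ) [IsFiniteMeasure μ]
    (hμ : Integrable (charFun μ)) (g : 𝓢(ℝ, ℂ)) :
    ∫ x, g x ∂μ = ∫ x, g x * 𝓕 (fun s : ℝ ↦ charFun μ (2 * π * s)) x := by
  have hψ : Integrable (fun s : ℝ ↦ charFun μ (2 * π * s)) :=
    hμ.comp_mul_left' (by positivity)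
  have hL : Continuous fun p : ℝ × ℝ ↦ innerₗ ℝ p.1 p.2 := continuous_inner
  have h_inv : ∀ x, VectorFourier.fourierIntegral 𝐞 volume (innerₗ ℝ) (𝓕⁻ g : 𝓢(ℝ, ℂ)) x = g x := by
    intro x
    have h : 𝓕 (𝓕⁻ g : 𝓢(ℝ, ℂ)) = g := FourierTransform.fourier_fourierInv_eq g
    exact DFunLike.congr_fun h x
  have h_char : ∀ x, VectorFourier.fourierIntegral 𝐞 μ (innerₗ ℝ) (1 : ℝ → ℂ) x
      = charFun μ (2 * π * (-x)) := by
    intro x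
    rw [charFun_eq_fourierIntegral']
    congr 1
    simp only [smul_eq_mul]
    field_simp
  have h_neg : ∀ x, (𝓕⁻ g : 𝓢(ℝ, ℂ)) (-x) = 𝓕 (g : ℝ → ℂ) x := by
    intro x
    rw [SchwartzMap.fourierInv_coe, Real.fourierInv_eq_fourier_neg, neg_neg]
  calc ∫ x, g x ∂μ
      = ∫ x, VectorFourier.fourierIntegral 𝐞 volume (innerₗ ℝ) (𝓕⁻ g : 𝓢(ℝ, ℂ)) x
          • (1 : ℝ → ℂ) x ∂μ := by simp [h_inv]
    _ = ∫ x, (𝓕⁻ g : 𝓢(ℝ, ℂ)) x • VectorFourier.fourierIntegral 𝐞 μ (innerₗ ℝ).flip 1 x :=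
        VectorFourier.integral_fourierIntegral_smul_eq_flip continuous_fourierChar hL
          (𝓕⁻ g : 𝓢(ℝ, ℂ)).integrable (integrable_const 1)
    _ = ∫ x, (𝓕⁻ g : 𝓢(ℝ, ℂ)) x * charFun μ (2 * π * (-x)) := by
        simp only [flip_innerₗ, h_char, smul_eq_mul]
    _ = ∫ x, (𝓕⁻ g : 𝓢(ℝ, ℂ)) (-x) * charFun μ (2 * π * x) := by
        rw [← integral_neg_eq_self]
        simp only [neg_neg]
    _ = ∫ x, 𝓕 (g : ℝ → ℂ) x • charFun μ (2 * π * x) := by simp only [h_neg, smul_eq_mul]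
    _ = ∫ x, g x • 𝓕 (fun s : ℝ ↦ charFun μ (2 * π * s)) x := by
        have := VectorFourier.integral_fourierIntegral_smul_eq_flip continuous_fourierChar hL
          g.integrable (μ := volume) (ν := volume) hψ
        rwa [flip_innerₗ] at this

/-- The Fourier transform of a rescaled integrable characteristic function is real, and is given by
an integral over the positive half-line. -/
lemma fourier_charFun_eq_integral_Ioi (μ : Measure ℝ)
    (hμ : Integrable (charFun μ)) (x : ℝ) :
    𝓕 (fun s : ℝ ↦ charFun μ (2 * π * s)) x = (((1 / π) * ∫ t in Set.Ioi (0 : ℝ),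
      (Complex.exp (-(Complex.I * t * x)) * charFun μ t).re : ℝ) : ℂ) := by
  set F : ℝ → ℂ := fun t ↦ Complex.exp (-(Complex.I * t * x)) * charFun μ t with hF
  have hF_int : Integrable F := by
    refine hμ.bdd_mul (c := 1) (by fun_prop) (ae_of_all _ fun t ↦ ?_)
    rw [Complex.norm_exp]
    simp
  have hF_neg : ∀ t, F (-t) = conj (F t) := by
    intro t
    simp [hF, charFun_neg, ← Complex.exp_conj]
  have h_scale : 𝓕 (fun s : ℝ ↦ charFun μ (2 * π * s)) x = ∫ s, F (2 * π * s) := by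
    rw [Real.fourier_eq']
    congr with s
    simp only [hF, smul_eq_mul]
    congr 2
    simp
    ring
  have h_half : ∫ t, F t = ((2 * ∫ t in Set.Ioi (0 : ℝ), (F t).re : ℝ) : ℂ) := by
    rw [← intervalIntegral.integral_Iic_add_Ioi hF_int.integrableOn hF_int.integrableOn (b := 0)]
    have := integral_comp_neg_Ioi 0 F
    rw [neg_zero] at this
    rw [← this]
    simp only [hF_neg]
    have hre : ∫ t in Set.Ioi (0 : ℝ), (F t).re = (∫ t in Set.Ioi (0 : ℝ), F t).re :=
      integral_re hF_int.integrableOn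
    rw [integral_conj, hre, add_comm, Complex.add_conj]
  rw [h_scale, Measure.integral_comp_mul_left F, h_half, abs_of_pos (by positivity), real_smul,
    ← ofReal_mul]
  congr 1
  field_simp
  rfl

/-- A finite measure on `ℝ` that integrates smooth compactly supported functions as a continuous
function `p` does is the measure with density `p`. -/
lemma eq_withDensity_of_forall_integral_contDiff_eq (μ : Measure ℝ) [IsFiniteMeasure μ]
    {p : ℝ → ℝ} (hp : Continuous p)
    (h : ∀ g : ℝ → ℝ, ContDiff ℝ (⊤ : ℕ∞) g → HasCompactSupport g →
      ∫ x, g x ∂μ = ∫ x, g x * p x) :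
    μ = volume.withDensity (fun x ↦ ENNReal.ofReal (p x)) := by
  have h_ball : ∀ c r : ℝ, 0 < r → μ.real (Metric.ball c r) = ∫ x in Metric.ball c r, p x := by
    intro c r hr
    let f : ℕ → ContDiffBump c := fun n ↦
      ⟨r * (1 - 1 / ((n : ℝ) + 2)), r, by
        refine mul_pos hr ?_
        rw [sub_pos, div_lt_one (by positivity)]
        linarith [n.cast_nonneg (α := ℝ)], by
        have : 0 < r * (1 / ((n : ℝ) + 2)) := by positivity
        linarith⟩
    have h_lim : ∀ x, Filter.Tendsto (fun n ↦ f n x) Filter.atTop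
        (nhds ((Metric.ball c r).indicator 1 x)) := by
      intro x
      apply tendsto_const_nhds.congr'
      by_cases hx : x ∈ Metric.ball c r
      · have h_rIn : Filter.Tendsto (fun n : ℕ ↦ r * (1 - 1 / ((n : ℝ) + 2))) Filter.atTop
            (nhds (r * (1 - 0))) := by
          have := (tendsto_one_div_add_atTop_nhds_zero_nat (𝕜 := ℝ)).comp
            (Filter.tendsto_add_atTop_nat 1)
          refine (tendsto_const_nhds.sub (this.congr fun n ↦ ?_)).const_mul r
          simp
          ring
        filter_upwards [h_rIn.eventually_const_lt (u := dist x c)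
          (by simpa using hx)] with n hn
        rw [(f n).one_of_mem_closedBall (Metric.mem_closedBall.2 hn.le)]
        simp [hx]
      · refine Filter.Eventually.of_forall fun n ↦ ?_
        simp [hx, (f n).zero_of_le_dist (by simpa [f] using hx)]
    have h_left : Filter.Tendsto (fun n ↦ ∫ x, f n x ∂μ) Filter.atTop
        (nhds (μ.real (Metric.ball c r))) := by
      rw [← integral_indicator_one Metric.isOpen_ball.measurableSet]
      refine tendsto_integral_of_dominated_convergence (fun _ ↦ 1)
        (fun n ↦ (f n).continuous.aestronglyMeasurable) (integrable_const _)
        (fun n ↦ ae_of_all _ fun x ↦ ?_) (ae_of_all _ h_lim)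
      rw [Real.norm_of_nonneg (f n).nonneg]
      exact (f n).le_one
    have h_right : Filter.Tendsto (fun n ↦ ∫ x, f n x * p x) Filter.atTop
        (nhds (∫ x in Metric.ball c r, p x)) := by
      rw [← integral_indicator Metric.isOpen_ball.measurableSet]
      refine tendsto_integral_of_dominated_convergence
        ((Metric.closedBall c r).indicator fun x ↦ |p x|)
        (fun n ↦ ((f n).continuous.mul hp).aestronglyMeasurable)
        ((hp.abs.continuousOn.integrableOn_compact
          (isCompact_closedBall c r)).integrable_indicator Metric.isClosed_closedBall.measurableSet)
        (fun n ↦ ae_of_all _ fun x ↦ ?_) (ae_of_all _ fun x ↦ ?_)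
      · by_cases hx : x ∈ Metric.closedBall c r
        · rw [Set.indicator_of_mem hx, norm_mul, Real.norm_of_nonneg (f n).nonneg, Real.norm_eq_abs]
          exact mul_le_of_le_one_left (abs_nonneg _) (f n).le_one
        · rw [Set.indicator_of_notMem hx, (f n).zero_of_le_dist (by simpa [f] using (not_le.1 hx).le)]
          simp
      · convert (h_lim x).mul_const (p x) using 2
        by_cases hx : x ∈ Metric.ball c r <;> simp [hx]
    refine tendsto_nhds_unique h_left (h_right.congr fun n ↦ ?_)
    exact (h _ (f n).contDiff (f n).hasCompactSupport).symm
  have hp_int : ∀ c r : ℝ, IntegrableOn p (Metric.ball c r) := fun c r ↦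
    (hp.continuousOn.integrableOn_compact (isCompact_closedBall c r)).mono_set
      Metric.ball_subset_closedBall
  have hp_nonneg : ∀ x, 0 ≤ p x := by
    intro x
    by_contra! hx
    obtain ⟨r, hr, hsub⟩ := Metric.isOpen_iff.1 (isOpen_lt hp continuous_const (g := fun _ ↦ 0)) x hx
    have h_neg : 0 < ∫ y in Metric.ball x r, -p y := by
      rw [setIntegral_pos_iff_support_of_nonneg_ae]
      · refine (Metric.measure_ball_pos volume x hr).trans_le (measure_mono fun y hy ↦ ⟨?_, hy⟩)
        have : p y < 0 := hsub hy
        simpa using this.ne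
      · filter_upwards [ae_restrict_mem Metric.isOpen_ball.measurableSet] with y hy
        have : p y < 0 := hsub hy
        simpa using this.le
      · exact (hp_int x r).neg
    rw [integral_neg, ← h_ball x r hr] at h_neg
    linarith [measureReal_nonneg (μ := μ) (s := Metric.ball x r)]
  refine Real.measure_ext_Ioo_rat fun a b ↦ ?_
  rcases le_or_gt (b : ℝ) a with hab | hab
  · simp [Set.Ioo_eq_empty_of_le hab]
  rw [Real.Ioo_eq_ball, withDensity_apply _ Metric.isOpen_ball.measurableSet,
    ← ofReal_integral_eq_lintegral_ofReal (hp_int _ _) (ae_of_all _ hp_nonneg),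
    ← h_ball _ _ (by linarith), ofReal_measureReal]

/-- Fourier inversion: if the characteristic function `φ` of a real random variable `X` is
Lebesgue integrable on ℝ, then `X` has a continuous probability density function given by
`pdf_X(x) = (1/π)·∫₀^∞ Re(exp(-i·t·x)·φ(t)) dt`. -/
theorem continuous_pdf_of_integrable_charFun
    {Ω : Type*} [MeasureSpace Ω] [IsProbabilityMeasure (volume : Measure Ω)]
    (X : Ω → ℝ) (hX : Measurable X)
    (φ : ℝ → ℂ) (hφ : ∀ t : ℝ, φ t = ∫ ω, Complex.exp (Complex.I * t * (X ω)))
    (hint : Integrable φ) :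
    Continuous (fun x : ℝ =>
      (1 / π) * ∫ t in Set.Ioi (0 : ℝ), (Complex.exp (-(Complex.I * t * x)) * φ t).re) ∧
    Measure.map X volume = volume.withDensity (fun x : ℝ => ENNReal.ofReal
      ((1 / π) * ∫ t in Set.Ioi (0 : ℝ), (Complex.exp (-(Complex.I * t * x)) * φ t).re)) := by
  have : IsProbabilityMeasure (Measure.map X volume) :=
    Measure.isProbabilityMeasure_map hX.aemeasurable
  have hφ_eq : φ = charFun (Measure.map X volume) := by
    ext t
    rw [hφ, charFun_apply_real, integral_map hX.aemeasurable (by fun_prop)]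
    congr with ω
    ring_nf
  subst hφ_eq
  have h_fourier := fourier_charFun_eq_integral_Ioi _ hint
  have h_cont : Continuous (fun x : ℝ => (1 / π) * ∫ t in Set.Ioi (0 : ℝ),
      (Complex.exp (-(Complex.I * t * x)) * charFun (Measure.map X volume) t).re) := by
    have : Continuous (𝓕 (fun s : ℝ ↦ charFun (Measure.map X volume) (2 * π * s))) :=
      VectorFourier.fourierIntegral_continuous continuous_fourierChar continuous_inner
        (hint.comp_mul_left' (by positivity))
    refine (continuous_re.comp this).congr fun x ↦ ?_
    rw [Function.comp_apply, h_fourier, ofReal_re]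
  refine ⟨h_cont, eq_withDensity_of_forall_integral_contDiff_eq _ h_cont fun g hg hg' ↦ ?_⟩
  have hgc : HasCompactSupport (fun x ↦ (g x : ℂ)) := hg'.comp_left ofReal_zero
  have h_schwartz : ∫ x, (g x : ℂ) ∂(Measure.map X volume)
      = ∫ x, (g x : ℂ) * 𝓕 (fun s : ℝ ↦ charFun (Measure.map X volume) (2 * π * s)) x :=
    integral_schwartz_eq_integral_mul_fourier_charFun _ hint
      (hgc.toSchwartzMap (ofRealCLM.contDiff.comp hg))
  simp only [h_fourier, ← ofReal_mul] at h_schwartz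
  rw [integral_complex_ofReal, integral_complex_ofReal] at h_schwartz
  exact ofReal_injective h_schwartz
end

section
/- Let X be a real random variable with characteristic function φ(t) = E[exp(i·t·X)] and cumulative distribution function F, and let x ∈ ℝ be a continuity point of F. Assume that the function t ↦ Im(exp(-i·t·x)·φ(t))/t is Lebesgue integrable on (0, ∞). Then the Gil-Pelaez inversion formula holds: F(x) = 1/2 - (1/π)·∫₀^∞ (Im(exp(-i·t·x)·φ(t))/t) dt. -/
open Real MeasureTheory Complex

theorem integral_exp_neg_mul_cos_Ioi {a : ℝ} (ha : 0 < a) (y : ℝ) :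
    ∫ t in Set.Ioi (0 : ℝ), Real.exp (-a * t) * Real.cos (t * y) = a / (a ^ 2 + y ^ 2) := by
  have hz : (-(a : ℂ) + y * I).re < 0 := by simpa using ha
  have h := congrArg Complex.re (integral_exp_mul_complex_Ioi hz 0)
  rw [← RCLike.re_eq_complex_re, ← integral_re (integrableOn_exp_mul_complex_Ioi hz 0)] at h
  simp only [RCLike.re_eq_complex_re] at h
  convert h using 1
  · refine integral_congr_ae (.of_forall fun t ↦ ?_)
    simp [Complex.exp_re, mul_comm]
  · simp [Complex.normSq_apply, pow_two, neg_div]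

theorem integrableOn_exp_neg_mul_sin_div {a : ℝ} (ha : 0 < a) (y : ℝ) :
    IntegrableOn (fun t : ℝ ↦ Real.exp (-a * t) * (Real.sin (t * y) / t)) (Set.Ioi 0) := by
  refine ((exp_neg_integrableOn_Ioi 0 ha).mul_const |y|).mono'
    (by fun_prop) (.of_forall fun t ↦ ?_)
  rw [norm_mul, norm_of_nonneg (Real.exp_pos _).le]
  gcongr
  rw [norm_div, Real.norm_eq_abs, Real.norm_eq_abs]
  refine div_le_of_le_mul₀ (abs_nonneg _) (abs_nonneg _) ?_
  rw [mul_comm, ← abs_mul]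
  exact Real.abs_sin_le_abs

theorem integral_exp_neg_mul_sin_div_Ioi {a : ℝ} (ha : 0 < a) (y : ℝ) :
    ∫ t in Set.Ioi (0 : ℝ), Real.exp (-a * t) * (Real.sin (t * y) / t) = Real.arctan (y / a) := by
  have hderiv (y : ℝ) : HasDerivAt
      (fun y ↦ ∫ t in Set.Ioi (0 : ℝ), Real.exp (-a * t) * (Real.sin (t * y) / t))
      (a / (a ^ 2 + y ^ 2)) y := by
    rw [← integral_exp_neg_mul_cos_Ioi ha]
    refine (hasDerivAt_integral_of_dominated_loc_of_deriv_le (s := Set.univ)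
      (bound := fun t ↦ Real.exp (-a * t))
      (F' := fun y t ↦ Real.exp (-a * t) * Real.cos (t * y)) Filter.univ_mem
      (.of_forall fun y ↦ (integrableOn_exp_neg_mul_sin_div ha y).aestronglyMeasurable)
      (integrableOn_exp_neg_mul_sin_div ha y) (by fun_prop) (.of_forall fun t y _ ↦ ?_)
      (exp_neg_integrableOn_Ioi 0 ha) ?_).2
    · rw [norm_mul, norm_of_nonneg (Real.exp_pos _).le]
      exact mul_le_of_le_one_right (Real.exp_pos _).le (Real.abs_cos_le_one _)
    · filter_upwards [ae_restrict_mem measurableSet_Ioi] with t ht y _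
      have ht0 : t ≠ 0 := (Set.mem_Ioi.mp ht).ne'
      refine (((((hasDerivAt_id y).const_mul t).sin).div_const t).const_mul
        (Real.exp (-a * t))).congr_deriv ?_
      simp [ht0]
  have harctan (y : ℝ) : HasDerivAt (fun y ↦ Real.arctan (y / a)) (a / (a ^ 2 + y ^ 2)) y := by
    refine ((hasDerivAt_id y).div_const a).arctan.congr_deriv ?_
    simp only [id]
    field_simp
  have hdiff (y : ℝ) := (hderiv y).sub (harctan y)
  simp only [sub_self] at hdiff
  have h := is_const_of_deriv_eq_zero (fun y ↦ (hdiff y).differentiableAt)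
    (fun y ↦ (hdiff y).deriv) y 0
  simpa [sub_eq_zero] using h

theorem exp_neg_sub_exp_neg_le (a b t : ℝ) :
    Real.exp (-a * t) - Real.exp (-b * t) ≤ (b - a) * t * Real.exp (-a * t) := by
  have h : Real.exp (-b * t) = Real.exp (-a * t) * Real.exp (-((b - a) * t)) := by
    rw [← Real.exp_add]; ring_nf
  nlinarith [Real.add_one_le_exp (-((b - a) * t)), Real.exp_pos (-a * t)]

/-- The difference of two exponentials vanishes at `0`, so no moment assumption on `Y` is needed
to exchange the integrals. -/
theorem integral_exp_sub_exp_mul_integral_sin_div {Ω : Type*} [MeasurableSpace Ω]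
    {μ : Measure Ω} [IsFiniteMeasure μ] {Y : Ω → ℝ} (hY : Measurable Y) {a b : ℝ}
    (ha : 0 < a) (hab : a ≤ b) :
    ∫ t in Set.Ioi (0 : ℝ), (Real.exp (-a * t) - Real.exp (-b * t)) *
        ((∫ ω, Real.sin (t * Y ω) ∂μ) / t) =
      ∫ ω, (Real.arctan (Y ω / a) - Real.arctan (Y ω / b)) ∂μ := by
  have hint : Integrable (Function.uncurry fun (t : ℝ) (ω : Ω) ↦
      (Real.exp (-a * t) - Real.exp (-b * t)) * (Real.sin (t * Y ω) / t))
      ((volume.restrict (Set.Ioi 0)).prod μ) := by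
    have hbound : Integrable (fun z : ℝ × Ω ↦ (b - a) * Real.exp (-a * z.1) * 1)
        ((volume.restrict (Set.Ioi 0)).prod μ) :=
      ((exp_neg_integrableOn_Ioi 0 ha).const_mul (b - a)).mul_prod (integrable_const 1)
    have hmem : ∀ᵐ z : ℝ × Ω ∂((volume.restrict (Set.Ioi 0)).prod μ), z.1 ∈ Set.Ioi (0 : ℝ) :=
      Measure.quasiMeasurePreserving_fst.ae (ae_restrict_mem measurableSet_Ioi)
    refine hbound.mono' (Measurable.aestronglyMeasurable (by unfold Function.uncurry; fun_prop)) ?_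
    filter_upwards [hmem] with ⟨t, ω⟩ ht
    have ht : 0 < t := ht
    have hnonneg : 0 ≤ Real.exp (-a * t) - Real.exp (-b * t) := by
      rw [sub_nonneg]; gcongr
    simp only [Function.uncurry_apply_pair, norm_mul, norm_div, norm_of_nonneg hnonneg,
      norm_of_nonneg ht.le, mul_one, ← mul_div_assoc]
    rw [div_le_iff₀ ht]
    calc _ ≤ Real.exp (-a * t) - Real.exp (-b * t) :=
          mul_le_of_le_one_right hnonneg (Real.abs_sin_le_one _)
      _ ≤ _ := (exp_neg_sub_exp_neg_le a b t).trans_eq (by ring)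
  simp_rw [← integral_div, ← integral_const_mul]
  rw [integral_integral_swap hint]
  refine integral_congr_ae (.of_forall fun ω ↦ ?_)
  simp only [sub_mul]
  rw [integral_sub (integrableOn_exp_neg_mul_sin_div ha _)
    (integrableOn_exp_neg_mul_sin_div (ha.trans_le hab) _),
    integral_exp_neg_mul_sin_div_Ioi ha, integral_exp_neg_mul_sin_div_Ioi (ha.trans_le hab)]

theorem tendsto_exp_sub_exp_one {t : ℝ} (ht : 0 < t) :
    Filter.Tendsto (fun m : ℝ ↦ Real.exp (-m⁻¹ * t) - Real.exp (-m * t)) Filter.atTop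
      (nhds 1) := by
  have h₁ : Filter.Tendsto (fun m : ℝ ↦ Real.exp (-m⁻¹ * t)) Filter.atTop (nhds 1) := by
    have h := (Real.continuous_exp.tendsto _).comp
      ((tendsto_inv_atTop_zero (𝕜 := ℝ)).neg.mul_const t)
    simpa [Function.comp_def] using h
  have h₂ : Filter.Tendsto (fun m : ℝ ↦ Real.exp (-m * t)) Filter.atTop (nhds 0) :=
    Real.tendsto_exp_atBot.comp (Filter.tendsto_neg_atTop_atBot.atBot_mul_const ht)
  simpa using h₁.sub h₂

theorem tendsto_arctan_div_inv_sub_arctan_div {y : ℝ} (hy : y ≠ 0) :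
    Filter.Tendsto (fun m : ℝ ↦ Real.arctan (y / m⁻¹) - Real.arctan (y / m)) Filter.atTop
      (nhds (if y ≤ 0 then -(π / 2) else π / 2)) := by
  have h₂ : Filter.Tendsto (fun m : ℝ ↦ Real.arctan (y / m)) Filter.atTop (nhds 0) := by
    simpa [Function.comp_def] using (Real.continuous_arctan.tendsto 0).comp (Filter.Tendsto.const_div_atTop
      Filter.tendsto_id y)
  rw [← sub_zero (ite _ _ _)]
  refine Filter.Tendsto.sub ?_ h₂
  simp only [div_inv_eq_mul]
  split_ifs with h
  · exact (tendsto_nhdsWithin_iff.mp Real.tendsto_arctan_atBot).1.comp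
      (Filter.tendsto_id.const_mul_atTop_of_neg (h.lt_of_ne hy))
  · exact (tendsto_nhdsWithin_iff.mp Real.tendsto_arctan_atTop).1.comp
      (Filter.tendsto_id.const_mul_atTop (not_le.mp h))

theorem measure_eq_zero_of_continuousAt_cdf {Ω : Type*} [MeasurableSpace Ω] {μ : Measure Ω}
    [IsFiniteMeasure μ] {X : Ω → ℝ} (hX : Measurable X) {x : ℝ}
    (hcont : ContinuousAt (fun y ↦ μ.real {ω | X ω ≤ y}) x) : μ {ω | X ω = x} = 0 := by
  suffices h : μ.real {ω | X ω = x} ≤ 0 by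
    exact (measureReal_eq_zero_iff).mp (h.antisymm measureReal_nonneg)
  have hlim : Filter.Tendsto (fun y ↦ μ.real {ω | X ω ≤ x} - μ.real {ω | X ω ≤ y})
      (nhdsWithin x (Set.Iio x)) (nhds 0) := by
    simpa using (hcont.tendsto.mono_left nhdsWithin_le_nhds).const_sub (μ.real {ω | X ω ≤ x})
  refine ge_of_tendsto hlim ?_
  filter_upwards [self_mem_nhdsWithin] with y (hy : y < x)
  have hsub : {ω | X ω ≤ y} ⊆ {ω | X ω ≤ x} := fun ω (h : X ω ≤ y) ↦ h.trans hy.le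
  rw [← measureReal_sdiff hsub (hX measurableSet_Iic)]
  exact measureReal_mono fun ω (h : X ω = x) ↦ ⟨h.le, by simpa [h] using hy⟩

theorem im_exp_neg_mul_integral_exp {Ω : Type*} [MeasurableSpace Ω] {μ : Measure Ω}
    [IsFiniteMeasure μ] {X : Ω → ℝ} (hX : Measurable X) (x t : ℝ) :
    (Complex.exp (-(I * t * x)) * ∫ ω, Complex.exp (I * t * X ω) ∂μ).im =
      ∫ ω, Real.sin (t * (X ω - x)) ∂μ := by
  have hform (ω : Ω) : Complex.exp (-(I * t * x)) * Complex.exp (I * t * X ω) =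
      Complex.exp ((t * (X ω - x) : ℝ) * I) := by
    rw [← Complex.exp_add]; push_cast; ring_nf
  simp_rw [← integral_const_mul, hform]
  rw [← RCLike.im_eq_complex_im, ← integral_im]
  · simp only [RCLike.im_eq_complex_im, Complex.exp_ofReal_mul_I_im]
  · exact (integrable_const (1 : ℝ)).mono' (Measurable.aestronglyMeasurable (by fun_prop))
      (.of_forall fun ω ↦ (Complex.norm_exp_ofReal_mul_I _).le)

/-- Gil-Pelaez inversion formula: if `x` is a continuity point of the CDF `F` of a real random
variable `X` with characteristic function `φ`, and `t ↦ Im(exp(-i·t·x)·φ(t))/t` is Lebesgue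
integrable on `(0, ∞)`, then `F(x) = 1/2 - (1/π)·∫₀^∞ Im(exp(-i·t·x)·φ(t))/t dt`. -/
theorem gil_pelaez_inversion
    {Ω : Type*} [MeasureSpace Ω] [IsProbabilityMeasure (volume : Measure Ω)]
    (X : Ω → ℝ) (hX : Measurable X)
    (φ : ℝ → ℂ) (hφ : ∀ t : ℝ, φ t = ∫ ω, Complex.exp (Complex.I * t * (X ω)))
    (F : ℝ → ℝ) (hF : ∀ y : ℝ, F y = (volume {ω | X ω ≤ y}).toReal)
    (x : ℝ) (hcont : ContinuousAt F x)
    (hint : IntegrableOn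
      (fun t : ℝ => (Complex.exp (-(Complex.I * t * x)) * φ t).im / t) (Set.Ioi 0)) :
    F x = 1 / 2 -
      (1 / π) * ∫ t in Set.Ioi (0 : ℝ), (Complex.exp (-(Complex.I * t * x)) * φ t).im / t := by
  obtain rfl : F = fun y ↦ volume.real {ω | X ω ≤ y} := funext hF
  obtain rfl : φ = fun t : ℝ ↦ ∫ ω, Complex.exp (I * t * X ω) := funext hφ
  simp only [im_exp_neg_mul_integral_exp hX] at hint ⊢
  set g : ℝ → ℝ := fun t ↦ (∫ ω, Real.sin (t * (X ω - x))) / t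
  have hY : Measurable fun ω ↦ X ω - x := hX.sub_const x
  have hatTop : Filter.Tendsto (fun n : ℕ ↦ (n : ℝ) + 1) Filter.atTop Filter.atTop :=
    Filter.tendsto_atTop_add_const_right _ _ tendsto_natCast_atTop_atTop
  have hinv (n : ℕ) : ((n : ℝ) + 1)⁻¹ ≤ n + 1 :=
    (inv_le_one_of_one_le₀ (by simp)).trans (by simp)
  have hlim₁ : Filter.Tendsto (fun n : ℕ ↦ ∫ t in Set.Ioi (0 : ℝ),
      (Real.exp (-((n : ℝ) + 1)⁻¹ * t) - Real.exp (-((n : ℝ) + 1) * t)) * g t) Filter.atTop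
      (nhds (∫ t in Set.Ioi (0 : ℝ), g t)) := by
    refine tendsto_integral_of_dominated_convergence (fun t ↦ ‖g t‖) (fun n ↦ ?_) hint.norm
      (fun n ↦ ?_) ?_
    · exact AEStronglyMeasurable.mul (by fun_prop) hint.aestronglyMeasurable
    · filter_upwards [ae_restrict_mem measurableSet_Ioi] with t (ht : 0 < t)
      rw [norm_mul]
      refine mul_le_of_le_one_left (norm_nonneg _) ?_
      rw [Real.norm_of_nonneg (sub_nonneg.mpr (by gcongr; exact hinv n))]
      have h₁ : Real.exp (-((n : ℝ) + 1)⁻¹ * t) ≤ 1 := by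
        rw [Real.exp_le_one_iff, neg_mul, neg_nonpos]; positivity
      linarith [Real.exp_pos (-((n : ℝ) + 1) * t)]
    · filter_upwards [ae_restrict_mem measurableSet_Ioi] with t ht
      simpa only [one_mul, Function.comp_apply] using ((tendsto_exp_sub_exp_one ht).comp hatTop).mul_const (g t)
  have hlim₂ : Filter.Tendsto (fun n : ℕ ↦ ∫ t in Set.Ioi (0 : ℝ),
      (Real.exp (-((n : ℝ) + 1)⁻¹ * t) - Real.exp (-((n : ℝ) + 1) * t)) * g t) Filter.atTop
      (nhds (∫ ω, (π / 2 - {ω | X ω ≤ x}.indicator (fun _ ↦ π) ω))) := by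
    simp_rw [g, fun n : ℕ ↦ integral_exp_sub_exp_mul_integral_sin_div (μ := volume) hY
      (inv_pos.mpr (n.cast_add_one_pos (α := ℝ))) (hinv n)]
    refine tendsto_integral_of_dominated_convergence (fun _ ↦ π)
      (fun n ↦ Measurable.aestronglyMeasurable (by fun_prop)) (integrable_const _)
      (fun n ↦ .of_forall fun ω ↦ ?_) ?_
    · rw [Real.norm_eq_abs, abs_le]
      constructor <;> linarith [Real.arctan_lt_pi_div_two ((X ω - x) / ((n : ℝ) + 1)⁻¹),
        Real.arctan_lt_pi_div_two ((X ω - x) / ((n : ℝ) + 1)),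
        Real.neg_pi_div_two_lt_arctan ((X ω - x) / ((n : ℝ) + 1)⁻¹),
        Real.neg_pi_div_two_lt_arctan ((X ω - x) / ((n : ℝ) + 1))]
    · have hne : ∀ᵐ ω, X ω ≠ x := by
        simpa [ae_iff] using measure_eq_zero_of_continuousAt_cdf hX hcont
      filter_upwards [hne] with ω hω
      have hval : π / 2 - {ω | X ω ≤ x}.indicator (fun _ ↦ π) ω =
          if X ω - x ≤ 0 then -(π / 2) else π / 2 := by
        simp only [Set.indicator_apply, Set.mem_ofPred_eq, sub_nonpos]
        split_ifs <;> ring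
      rw [hval]
      exact (tendsto_arctan_div_inv_sub_arctan_div (sub_ne_zero.mpr hω)).comp hatTop
  have hmeas : MeasurableSet {ω | X ω ≤ x} := hX measurableSet_Iic
  have hval := tendsto_nhds_unique hlim₁ hlim₂
  rw [integral_sub (integrable_const _) ((integrable_const π).indicator hmeas),
    integral_indicator_const _ hmeas] at hval
  simp only [integral_const, probReal_univ, smul_eq_mul, one_mul] at hval
  rw [hval]
  field_simp
  ring
end
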